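/- Correctness of one round of Light-SS (uniform sampling of non-bundle edges): let V be a finite type with n = |V| ≥ 1, E a finite type, M : E → Matrix V V ℝ a family of positive semidefinite matrices, and L = Σ_{e ∈ E} M e. Let J ⊆ E be a finite subset, and let S ∈ (0,1] and ε ∈ [0,1] be reals such that for every e ∉ J the matrix (S/4) • L − M e is positive semidefinite. For σ : E → Fin 4 define L_H(σ) = Σ_{e ∈ J} M e + Σ_{e ∉ J, σ e = 0} 4 • M e (so each non-bundle summand is kept with probability 1/4 and rescaled by 4). Then the number of σ : E → Fin 4 for which it is NOT the case that both L_H(σ) − (1−ε) • L and (1+ε) • L − L_H(σ) are positive semidefinite is at most 2·n·exp(−ε²/(3S)) · 4^{|E|}; equivalently, under uniform i.i.d. sampling, (1−ε) L ⪯ L_H ⪯ (1+ε) L holds with probability at least 1 − 2n·exp(−ε²/(3S)). (This is the probabilistic core of the proof of Theorem 3.) -/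

import Mathlib

open Matrix

section
open NormedSpace Filter Topology

theorem NormedSpace.norm_exp_le_exp_norm {𝔸 : Type*} [NormedRing 𝔸] [NormedAlgebra ℝ 𝔸]
    [CompleteSpace 𝔸] [NormOneClass 𝔸] (x : 𝔸) : ‖exp x‖ ≤ Real.exp ‖x‖ := by
  rw [exp_eq_tsum ℝ, Real.exp_eq_exp_ℝ, exp_eq_tsum ℝ]
  refine (norm_tsum_le_tsum_norm (norm_expSeries_summable' (𝕂 := ℝ) x)).trans ?_
  refine (norm_expSeries_summable' (𝕂 := ℝ) x).tsum_le_tsum (fun n => ?_)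
    (expSeries_summable' (𝕂 := ℝ) ‖x‖)
  rw [norm_smul, smul_eq_mul, Real.norm_of_nonneg (by positivity)]
  gcongr
  exact norm_pow_le x n

theorem norm_pow_sub_pow_le_mul_norm_sub {𝔸 : Type*} [NormedRing 𝔸] [NormOneClass 𝔸]
    {x y : 𝔸} {c : ℝ} (hx : ‖x‖ ≤ c) (hy : ‖y‖ ≤ c) (n : ℕ) :
    ‖x ^ (n + 1) - y ^ (n + 1)‖ ≤ (n + 1) * c ^ n * ‖x - y‖ := by
  have hc : 0 ≤ c := (norm_nonneg x).trans hx
  induction n with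
  | zero => simp
  | succ n ih =>
    have h : x ^ (n + 1 + 1) - y ^ (n + 1 + 1)
        = x ^ (n + 1) * (x - y) + (x ^ (n + 1) - y ^ (n + 1)) * y := by
      rw [pow_succ x (n + 1), pow_succ y (n + 1)]; noncomm_ring
    rw [h]
    have h1 : ‖x ^ (n + 1)‖ ≤ c ^ (n + 1) := (norm_pow_le x _).trans (by gcongr)
    calc _ ≤ ‖x ^ (n + 1)‖ * ‖x - y‖ + ‖x ^ (n + 1) - y ^ (n + 1)‖ * ‖y‖ :=
          (norm_add_le _ _).trans (add_le_add (norm_mul_le _ _) (norm_mul_le _ _))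
      _ ≤ c ^ (n + 1) * ‖x - y‖ + ((n + 1) * c ^ n * ‖x - y‖) * c := by gcongr
      _ = _ := by push_cast; ring

/-- The **Lie product formula**. -/
theorem NormedSpace.tendsto_exp_mul_exp_pow {𝔸 : Type*} [NormedRing 𝔸] [NormedAlgebra ℝ 𝔸]
    [CompleteSpace 𝔸] [NormOneClass 𝔸] (a b : 𝔸) :
    Tendsto (fun n : ℕ => (exp (((n : ℝ) + 1)⁻¹ • a) * exp (((n : ℝ) + 1)⁻¹ • b)) ^ (n + 1))
      atTop (𝓝 (exp (a + b))) := by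
  have hd : HasDerivAt (fun t : ℝ => exp (t • a) * exp (t • b) - exp (t • (a + b))) 0 0 := by
    have h := ((hasDerivAt_exp_smul_const a (0 : ℝ)).mul
      (hasDerivAt_exp_smul_const b (0 : ℝ))).sub (hasDerivAt_exp_smul_const (a + b) (0 : ℝ))
    exact h.congr_deriv (by simp)
  have hlim : Tendsto (fun n : ℕ => ((n : ℝ) + 1)⁻¹) atTop (𝓝[≠] 0) := by
    refine tendsto_nhdsWithin_iff.2 ⟨?_, Eventually.of_forall fun n => ?_⟩
    · simpa using tendsto_one_div_add_atTop_nhds_zero_nat (𝕜 := ℝ)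
    · have : (0 : ℝ) < ((n : ℝ) + 1)⁻¹ := by positivity
      exact this.ne'
  have hs := (hasDerivAt_iff_tendsto_slope_zero.1 hd).comp hlim
  have hs' : Tendsto (fun n : ℕ => ((n : ℝ) + 1) * ‖exp (((n : ℝ) + 1)⁻¹ • a) *
      exp (((n : ℝ) + 1)⁻¹ • b) - exp (((n : ℝ) + 1)⁻¹ • (a + b))‖) atTop (𝓝 0) := by
    have := hs.norm
    simp only [norm_zero] at this
    refine this.congr fun n => ?_
    simp only [Function.comp, zero_add, zero_smul, exp_zero, inv_inv, mul_one, sub_self, sub_zero]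
    rw [norm_smul, Real.norm_of_nonneg (by positivity)]
  rw [tendsto_iff_norm_sub_tendsto_zero]
  refine squeeze_zero (fun _ => norm_nonneg _) (fun n => ?_)
    (by simpa only [mul_zero] using hs'.const_mul (Real.exp (‖a‖ + ‖b‖)))
  set s : ℝ := ((n : ℝ) + 1)⁻¹ with hsdef
  have hs0 : 0 ≤ s := by positivity
  have hsn : ((n : ℝ) + 1) * s = 1 := mul_inv_cancel₀ (by positivity)
  have hns : (n : ℝ) * s ≤ 1 := by linarith
  have hy : exp (a + b) = exp (s • (a + b)) ^ (n + 1) := by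
    let +nondep : NormedAlgebra ℚ 𝔸 := .restrictScalars ℚ ℝ 𝔸
    rw [← exp_nsmul, ← Nat.cast_smul_eq_nsmul ℝ, smul_smul]
    push_cast
    rw [hsn, one_smul]
  have h1 : ‖exp (s • a) * exp (s • b)‖ ≤ Real.exp (s * (‖a‖ + ‖b‖)) := by
    refine (norm_mul_le _ _).trans ?_
    rw [mul_add, Real.exp_add]
    gcongr
    · exact (norm_exp_le_exp_norm _).trans (by rw [norm_smul, Real.norm_of_nonneg hs0])
    · exact (norm_exp_le_exp_norm _).trans (by rw [norm_smul, Real.norm_of_nonneg hs0])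
  have h2 : ‖exp (s • (a + b))‖ ≤ Real.exp (s * (‖a‖ + ‖b‖)) := by
    refine (norm_exp_le_exp_norm _).trans ?_
    rw [norm_smul, Real.norm_of_nonneg hs0]
    gcongr
    exact norm_add_le _ _
  rw [hy]
  refine (norm_pow_sub_pow_le_mul_norm_sub h1 h2 n).trans ?_
  rw [mul_comm ((n : ℝ) + 1) _, mul_assoc]
  gcongr
  rw [← Real.exp_nat_mul]
  gcongr
  nlinarith [mul_le_mul_of_nonneg_right hns (add_nonneg (norm_nonneg a) (norm_nonneg b))]
end

namespace Matrix

section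
variable {V : Type*} [Fintype V]

theorem trace_mul_conjTranspose_le (A B : Matrix V V ℝ) :
    (A * Bᴴ).trace ≤ ((A * Aᴴ).trace + (B * Bᴴ).trace) / 2 := by
  have h := (posSemidef_self_mul_conjTranspose (A - B)).trace_nonneg
  have h2 : (B * Aᴴ).trace = (A * Bᴴ).trace := by
    simpa using trace_conjTranspose (A * Bᴴ)
  simp only [conjTranspose_sub, sub_mul, mul_sub, trace_sub] at h
  linarith

variable [DecidableEq V]

theorem trace_mul_pow_comm (A B : Matrix V V ℝ) (k : ℕ) :
    ((A * B) ^ k).trace = ((B * A) ^ k).trace := by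
  cases k with
  | zero => simp
  | succ k =>
    have h : A * (B * A) ^ k = (A * B) ^ k * A := by
      induction k with
      | zero => simp
      | succ k ih => rw [pow_succ, ← mul_assoc, ih, pow_succ]; simp only [mul_assoc]
    rw [pow_succ, ← mul_assoc, ← h, trace_mul_comm, pow_succ', mul_assoc]

theorem trace_pow_two_pow_le_aux (k : ℕ) :
    (∀ Z : Matrix V V ℝ, (Z ^ 2 ^ (k + 1)).trace ≤ ((Z * Zᴴ) ^ 2 ^ k).trace) ∧
    ∀ A B : Matrix V V ℝ, A.IsHermitian → B.IsHermitian →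
      ((A * B) ^ 2 ^ k).trace ≤ (A ^ 2 ^ k * B ^ 2 ^ k).trace := by
  induction k with
  | zero =>
    refine ⟨fun Z => ?_, fun A B _ _ => by simp⟩
    have h := trace_mul_conjTranspose_le Z Zᴴ
    rw [conjTranspose_conjTranspose, trace_mul_comm Zᴴ Z] at h
    simpa [pow_two] using h
  | succ k ih =>
    obtain ⟨ihZ, ihG⟩ := ih
    refine ⟨fun Z => ?_, fun A B hA hB => ?_⟩
    · have hP : (Zᴴ * Z).IsHermitian := isHermitian_conjTranspose_mul_self Z
      have hQ : (Z * Zᴴ).IsHermitian := isHermitian_mul_conjTranspose_self Z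
      have h1 := ihZ (Z ^ 2)
      have h2 : ((Z ^ 2 * (Z ^ 2)ᴴ) ^ 2 ^ k).trace = (((Zᴴ * Z) * (Z * Zᴴ)) ^ 2 ^ k).trace := by
        have : Z ^ 2 * (Z ^ 2)ᴴ = (Z * Z * Zᴴ) * Zᴴ := by
          rw [conjTranspose_pow, pow_two, pow_two]; simp only [mul_assoc]
        rw [this, trace_mul_pow_comm]; simp only [mul_assoc]
      have h3 := ihG _ _ hP hQ
      have h4 := trace_mul_conjTranspose_le ((Zᴴ * Z) ^ 2 ^ k) ((Z * Zᴴ) ^ 2 ^ k)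
      rw [(hQ.pow _).eq, (hP.pow _).eq, ← pow_add, ← pow_add, ← two_mul, ← pow_succ',
        trace_mul_pow_comm Zᴴ Z] at h4
      rw [← pow_mul, ← pow_succ'] at h1
      linarith
    · have h1 := ihZ (A * B)
      have h2 : (((A * B) * (A * B)ᴴ) ^ 2 ^ k).trace = ((A ^ 2 * B ^ 2) ^ 2 ^ k).trace := by
        have : (A * B) * (A * B)ᴴ = (A * B ^ 2) * A := by
          rw [conjTranspose_mul, hA.eq, hB.eq, pow_two]; simp only [mul_assoc]
        rw [this, trace_mul_pow_comm, pow_two A]; simp only [mul_assoc]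
      have h3 := ihG _ _ (hA.pow 2) (hB.pow 2)
      rw [← pow_mul, ← pow_mul, ← pow_succ'] at h3
      linarith

theorem trace_mul_pow_two_pow_le {A B : Matrix V V ℝ} (hA : A.IsHermitian) (hB : B.IsHermitian)
    (k : ℕ) : ((A * B) ^ 2 ^ k).trace ≤ (A ^ 2 ^ k * B ^ 2 ^ k).trace :=
  (trace_pow_two_pow_le_aux k).2 A B hA hB

open NormedSpace Filter Topology in
/-- The **Golden–Thompson inequality** for real symmetric matrices. -/
theorem trace_exp_add_le {A B : Matrix V V ℝ} (hA : A.IsHermitian)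
    (hB : B.IsHermitian) : (exp (A + B)).trace ≤ (exp A * exp B).trace := by
  rcases isEmpty_or_nonempty V with hV | hV
  · simp [trace]
  open scoped Matrix.Norms.Operator in
  have hone : NormOneClass (Matrix V V ℝ) := linfty_opNormOneClass
  have hlie := tendsto_exp_mul_exp_pow A B
  have hsub : Tendsto (fun k : ℕ => 2 ^ k - 1) atTop atTop :=
    (tendsto_sub_atTop_nat 1).comp (tendsto_pow_atTop_atTop_of_one_lt one_lt_two)
  have htr : Continuous (trace : Matrix V V ℝ → ℝ) := continuous_id.matrix_trace
  refine le_of_tendsto ((htr.tendsto _).comp (hlie.comp hsub)) (Eventually.of_forall fun k => ?_)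
  have h2 : 2 ^ k - 1 + 1 = 2 ^ k := Nat.sub_add_cancel Nat.one_le_two_pow
  have hc : (((2 ^ k - 1 : ℕ) : ℝ) + 1) = ((2 ^ k : ℕ) : ℝ) := by rw [← h2]; push_cast; simp
  have hexp (C : Matrix V V ℝ) : exp (((2 ^ k : ℕ) : ℝ)⁻¹ • C) ^ 2 ^ k = exp C := by
    rw [← Matrix.exp_nsmul, ← Nat.cast_smul_eq_nsmul ℝ, smul_smul, mul_inv_cancel₀ (by positivity),
      one_smul]
  have hh (C : Matrix V V ℝ) (hC : C.IsHermitian) :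
      (exp (((2 ^ k : ℕ) : ℝ)⁻¹ • C)).IsHermitian :=
    IsHermitian.exp (by rw [IsHermitian, conjTranspose_smul, hC.eq, star_trivial])
  simp only [Function.comp, h2, hc]
  refine (trace_mul_pow_two_pow_le (hh A hA) (hh B hB) k).trans ?_
  rw [hexp, hexp]

theorem PosSemidef.trace_mul_nonneg {A B : Matrix V V ℝ} (hA : A.PosSemidef) (hB : B.PosSemidef) :
    0 ≤ (A * B).trace := by
  open scoped MatrixOrder in
  obtain ⟨C, rfl⟩ := CStarAlgebra.nonneg_iff_eq_star_mul_self.mp hA.nonneg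
  rw [mul_assoc, trace_mul_comm]
  exact (hB.mul_mul_conjTranspose_same C).trace_nonneg

namespace IsHermitian

theorem eq_conj_diagonal_eigenvalues {A : Matrix V V ℝ} (hA : A.IsHermitian) :
    A = hA.eigenvectorUnitary * diagonal hA.eigenvalues *
      star (hA.eigenvectorUnitary : Matrix V V ℝ) := by
  conv_lhs => rw [hA.spectral_theorem, Unitary.conjStarAlgAut_apply]
  rfl

theorem conj_diagonal_const {A : Matrix V V ℝ} (hA : A.IsHermitian) (c : ℝ) :
    (hA.eigenvectorUnitary : Matrix V V ℝ) * diagonal (fun _ => c) *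
      star (hA.eigenvectorUnitary : Matrix V V ℝ) = c • 1 := by
  rw [← smul_one_eq_diagonal, mul_smul_comm, smul_mul_assoc, mul_one,
    Unitary.mul_star_self_of_mem hA.eigenvectorUnitary.2]

theorem exp_smul_eq {A : Matrix V V ℝ} (hA : A.IsHermitian) (c : ℝ) :
    NormedSpace.exp (c • A) = hA.eigenvectorUnitary *
      diagonal (fun i => Real.exp (c * hA.eigenvalues i)) *
      star (hA.eigenvectorUnitary : Matrix V V ℝ) := by
  have hinv : (hA.eigenvectorUnitary : Matrix V V ℝ)⁻¹ =
      star (hA.eigenvectorUnitary : Matrix V V ℝ) :=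
    inv_eq_right_inv (Unitary.coe_mul_star_self _)
  have hU : IsUnit (hA.eigenvectorUnitary : Matrix V V ℝ) := Unitary.isUnit_coe
  have h : c • A = hA.eigenvectorUnitary * diagonal (fun i => c * hA.eigenvalues i) *
      (hA.eigenvectorUnitary : Matrix V V ℝ)⁻¹ := by
    conv_lhs => rw [hA.eq_conj_diagonal_eigenvalues]
    rw [hinv, ← smul_mul_assoc, ← mul_smul_comm, ← diagonal_smul]
    rfl
  rw [h, exp_conj _ _ hU, exp_diagonal, hinv]
  congr 3
  ext i
  rw [Pi.coe_exp, Real.exp_eq_exp_ℝ]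

theorem trace_conj_diagonal {A : Matrix V V ℝ} (hA : A.IsHermitian) (d : V → ℝ) :
    (hA.eigenvectorUnitary * diagonal d *
      star (hA.eigenvectorUnitary : Matrix V V ℝ)).trace = ∑ i, d i := by
  rw [trace_mul_comm, ← mul_assoc, Unitary.coe_star_mul_self, one_mul, trace_diagonal]

theorem posSemidef_conj_diagonal_iff {A : Matrix V V ℝ} (hA : A.IsHermitian) {d : V → ℝ} :
    (hA.eigenvectorUnitary * diagonal d *
      star (hA.eigenvectorUnitary : Matrix V V ℝ)).PosSemidef ↔ ∀ i, 0 ≤ d i := by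
  rw [(Unitary.isUnit_coe (U := hA.eigenvectorUnitary)).posSemidef_star_right_conjugate_iff, posSemidef_diagonal_iff]

theorem posSemidef_smul_one_sub_iff {A : Matrix V V ℝ} (hA : A.IsHermitian) (c : ℝ) :
    (c • 1 - A).PosSemidef ↔ ∀ i, hA.eigenvalues i ≤ c := by
  have h : c • 1 - A = hA.eigenvectorUnitary * diagonal (fun i => c - hA.eigenvalues i) *
      star (hA.eigenvectorUnitary : Matrix V V ℝ) := by
    rw [← diagonal_sub, mul_sub, sub_mul, hA.conj_diagonal_const,
      ← hA.eq_conj_diagonal_eigenvalues]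
  rw [h, hA.posSemidef_conj_diagonal_iff]
  simp only [sub_nonneg]

theorem posSemidef_sub_smul_one_iff {A : Matrix V V ℝ} (hA : A.IsHermitian) (c : ℝ) :
    (A - c • 1).PosSemidef ↔ ∀ i, c ≤ hA.eigenvalues i := by
  have h : A - c • 1 = hA.eigenvectorUnitary * diagonal (fun i => hA.eigenvalues i - c) *
      star (hA.eigenvectorUnitary : Matrix V V ℝ) := by
    rw [← diagonal_sub, mul_sub, sub_mul, hA.conj_diagonal_const,
      ← hA.eq_conj_diagonal_eigenvalues]
  rw [h, hA.posSemidef_conj_diagonal_iff]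
  simp only [sub_nonneg]

theorem trace_exp_smul {A : Matrix V V ℝ} (hA : A.IsHermitian) (c : ℝ) :
    (NormedSpace.exp (c • A)).trace = ∑ i, Real.exp (c * hA.eigenvalues i) := by
  rw [hA.exp_smul_eq, hA.trace_conj_diagonal]

theorem posSemidef_exp {A : Matrix V V ℝ} (hA : A.IsHermitian) :
    (NormedSpace.exp A).PosSemidef := by
  have h := hA.exp_smul_eq 1
  rw [one_smul] at h
  rw [h, hA.posSemidef_conj_diagonal_iff]
  intro i
  positivity

theorem trace_exp_le {A : Matrix V V ℝ} (hA : A.IsHermitian) {c : ℝ}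
    (hc : (c • 1 - A).PosSemidef) :
    (NormedSpace.exp A).trace ≤ Fintype.card V * Real.exp c := by
  have h := hA.trace_exp_smul 1
  rw [one_smul] at h
  rw [h, ← nsmul_eq_mul, ← Finset.card_univ]
  refine Finset.sum_le_card_nsmul _ _ _ fun i _ => ?_
  rw [one_mul]
  exact Real.exp_le_exp.2 ((hA.posSemidef_smul_one_sub_iff c).1 hc i)

end IsHermitian

theorem sum_trace_exp_add_le {ι : Type*} [Fintype ι] {H : Matrix V V ℝ} (hH : H.IsHermitian)
    {Y : ι → Matrix V V ℝ} (hY : ∀ i, (Y i).IsHermitian)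
    (hmgf : ((Fintype.card ι : ℝ) • 1 - ∑ i, NormedSpace.exp (Y i)).PosSemidef) :
    ∑ i, (NormedSpace.exp (H + Y i)).trace ≤ Fintype.card ι * (NormedSpace.exp H).trace := by
  have h := hH.posSemidef_exp.trace_mul_nonneg hmgf
  rw [mul_sub, trace_sub, mul_smul_comm, mul_one, trace_smul, smul_eq_mul, Finset.mul_sum,
    trace_sum] at h
  have h2 : ∑ i, (NormedSpace.exp (H + Y i)).trace
      ≤ ∑ i, (NormedSpace.exp H * NormedSpace.exp (Y i)).trace :=
    Finset.sum_le_sum fun i _ => trace_exp_add_le hH (hY i)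
  linarith

end
end Matrix

theorem Fintype.sum_sum_update {E ι R : Type*} [Fintype E] [DecidableEq E] [Fintype ι]
    [Semiring R] (a : E) (F : (E → ι) → R) :
    ∑ σ : E → ι, ∑ i, F (Function.update σ a i) = Fintype.card ι * ∑ σ, F σ := by
  let f : (E → ι) × ι → (E → ι) × ι := fun p => (Function.update p.1 a p.2, p.1 a)
  have hf : Function.Involutive f := fun p => by simp [f]
  calc ∑ σ : E → ι, ∑ i, F (Function.update σ a i)
      = ∑ p : (E → ι) × ι, F (f p).1 := (Fintype.sum_prod_type' _).symm
    _ = ∑ p : (E → ι) × ι, F p.1 := Equiv.sum_comp hf.toPerm fun p => F p.1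
    _ = _ := by rw [Fintype.sum_prod_type]; simp [Finset.mul_sum]

namespace Matrix

theorem sum_trace_exp_add_sum_le {V E ι : Type*} [Fintype V] [DecidableEq V] [Fintype E]
    [DecidableEq E] [Fintype ι] [Nonempty ι] {H : Matrix V V ℝ} (hH : H.IsHermitian)
    {Y : E → ι → Matrix V V ℝ} (s : Finset E) (hY : ∀ e ∈ s, ∀ i, (Y e i).IsHermitian)
    (hmgf : ∀ e ∈ s,
      ((Fintype.card ι : ℝ) • 1 - ∑ i, NormedSpace.exp (Y e i)).PosSemidef) :
    ∑ σ : E → ι, (NormedSpace.exp (H + ∑ e ∈ s, Y e (σ e))).trace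
      ≤ Fintype.card ι ^ Fintype.card E * (NormedSpace.exp H).trace := by
  induction s using Finset.induction_on with
  | empty => simp
  | insert a s ha ih =>
    refine le_trans ?_ (ih (fun e he => hY e (Finset.mem_insert_of_mem he))
      fun e he => hmgf e (Finset.mem_insert_of_mem he))
    have hpos : (0 : ℝ) < Fintype.card ι := by exact_mod_cast Fintype.card_pos
    rw [← mul_le_mul_iff_right₀ hpos, ← Fintype.sum_sum_update a, Finset.mul_sum]
    refine Finset.sum_le_sum fun σ _ => ?_
    have hsum : (∑ e ∈ s, Y e (σ e)).IsHermitian := by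
      rw [IsHermitian, conjTranspose_sum]
      exact Finset.sum_congr rfl fun e he => hY e (Finset.mem_insert_of_mem he) _
    have h := sum_trace_exp_add_le (hH.add hsum) (hY a (Finset.mem_insert_self a s))
      (hmgf a (Finset.mem_insert_self a s))
    refine le_of_eq_of_le (Finset.sum_congr rfl fun i _ => ?_) h
    rw [Finset.sum_insert ha, Function.update_self, add_comm (Y a i), ← add_assoc]
    congr 4
    refine Finset.sum_congr rfl fun e he => ?_
    rw [Function.update_of_ne (ne_of_mem_of_not_mem he ha)]


theorem _root_.Real.exp_mul_le_one_add_mul {c t : ℝ} (hc0 : 0 ≤ c) (hc1 : c ≤ 1) :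
    Real.exp (c * t) ≤ 1 + c * (Real.exp t - 1) := by
  have h := convexOn_exp.2 (Set.mem_univ 0) (Set.mem_univ t) (sub_nonneg.2 hc1) hc0 (by ring)
  simp only [smul_eq_mul, mul_zero, zero_add, Real.exp_zero, mul_one] at h
  linarith

section
variable {V : Type*} [Fintype V] [DecidableEq V]

theorem posSemidef_four_sub_sum_exp {A : Matrix V V ℝ} (hA : A.PosSemidef) {S : ℝ} (hS : 0 < S)
    (hAS : ((S / 4) • 1 - A).PosSemidef) (t : ℝ) :
    ((Fintype.card (Fin 4) : ℝ) • 1 - ∑ i : Fin 4, NormedSpace.exp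
      (((if i = 0 then 4 * (t / S) else 0) - (Real.exp t - 1) / S) • A)).PosSemidef := by
  have hle := (hA.1.posSemidef_smul_one_sub_iff (S / 4)).1 hAS
  have hnn := hA.eigenvalues_nonneg
  rw [← hA.1.conj_diagonal_const]
  simp only [hA.1.exp_smul_eq]
  have hdiag (f : Fin 4 → V → ℝ) : ∑ i, diagonal (f i) = diagonal (∑ i, f i) :=
    (map_sum (diagonalAddMonoidHom V ℝ) f Finset.univ).symm
  rw [← Finset.sum_mul, ← Finset.mul_sum, ← sub_mul, ← mul_sub, hdiag, diagonal_sub,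
    hA.1.posSemidef_conj_diagonal_iff]
  intro j
  set a := hA.1.eigenvalues j with ha
  obtain ⟨c, hc⟩ : ∃ c, c = 4 * a / S := ⟨_, rfl⟩
  have hac : a = c * S / 4 := by rw [hc]; field_simp
  have hc0 : 0 ≤ c := by rw [hc]; have := hnn j; positivity
  have hc1 : c ≤ 1 := by rw [hc, div_le_one hS]; linarith [hle j]
  have h1 := Real.exp_mul_le_one_add_mul (t := t) hc0 hc1
  have h2 := Real.add_one_le_exp ((Real.exp t - 1) / S * a)
  have h3 : (Real.exp t - 1) / S * a = c * (Real.exp t - 1) / 4 := by rw [hac]; field_simp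
  have h4 : (4 * (t / S) - (Real.exp t - 1) / S) * a
      = c * t + -((Real.exp t - 1) / S * a) := by rw [hac]; field_simp; ring
  have h5 : Real.exp ((Real.exp t - 1) / S * a) * Real.exp (-((Real.exp t - 1) / S * a)) = 1 := by
    rw [← Real.exp_add]; simp
  have h6 := Real.exp_pos (-((Real.exp t - 1) / S * a))
  simp only [Finset.sum_apply, Fin.sum_univ_four, ← ha, Fintype.card_fin]
  simp only [Fin.isValue, reduceIte, one_ne_zero, Fin.reduceEq, zero_sub, h4, Real.exp_add,
    neg_mul, Nat.cast_ofNat]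
  rw [h3] at h2 h5 h6 ⊢
  nlinarith

/-- Matrix moment generating function bound for a sampled decomposition of the identity. -/
theorem sum_trace_exp_sample_le {E : Type*} [Fintype E] [DecidableEq E] {K : Matrix V V ℝ}
    (hK : K.PosSemidef) {A : E → Matrix V V ℝ} {T : Finset E} (hA : ∀ e ∈ T, (A e).PosSemidef)
    (hsum : K + ∑ e ∈ T, A e = 1) {S : ℝ} (hS : 0 < S)
    (hAS : ∀ e ∈ T, ((S / 4) • 1 - A e).PosSemidef) (t : ℝ) :
    ∑ σ : E → Fin 4, (NormedSpace.exp
        ((t / S) • (K + ∑ e ∈ T.filter (fun e => σ e = 0), (4 : ℝ) • A e))).trace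
      ≤ 4 ^ Fintype.card E * (Fintype.card V * Real.exp ((Real.exp t - 1) / S)) := by
  have hherm {B : Matrix V V ℝ} (hB : B.IsHermitian) (c : ℝ) : (c • B).IsHermitian := by
    rw [IsHermitian, conjTranspose_smul, hB.eq, star_trivial]
  set g := (Real.exp t - 1) / S with hg
  have hgt : 0 ≤ g - t / S := by
    rw [hg, ← sub_div]
    have := Real.add_one_le_exp t
    exact div_nonneg (by linarith) hS.le
  have hH : (g • 1 - (g - t / S) • K).IsHermitian := (hherm isHermitian_one g).sub (hherm hK.1 _)
  have hmain := sum_trace_exp_add_sum_le hH T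
    (Y := fun e (i : Fin 4) => ((if i = 0 then 4 * (t / S) else 0) - g) • A e)
    (fun e he i => hherm (hA e he).1 _)
    (fun e he => posSemidef_four_sub_sum_exp (hA e he) hS (hAS e he) t)
  have htr : (NormedSpace.exp (g • 1 - (g - t / S) • K)).trace ≤ Fintype.card V * Real.exp g := by
    refine hH.trace_exp_le ?_
    rw [sub_sub_cancel]
    exact hK.smul hgt
  rw [Fintype.card_fin] at hmain
  refine le_trans (le_of_eq ?_) (hmain.trans ?_)
  · refine Finset.sum_congr rfl fun σ _ => ?_
    congr 2
    have hK' : K = 1 - ∑ e ∈ T, A e := eq_sub_of_add_eq hsum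
    simp only [sub_smul, Finset.sum_sub_distrib, ← Finset.smul_sum]
    have h1 : ∑ e ∈ T, (if σ e = 0 then 4 * (t / S) else 0) • A e
        = (t / S) • ∑ e ∈ T.filter (fun e => σ e = 0), (4 : ℝ) • A e := by
      rw [Finset.sum_filter, Finset.smul_sum]
      refine Finset.sum_congr rfl fun e _ => ?_
      split_ifs
      · rw [smul_smul, mul_comm]
      · simp
    rw [h1, smul_add, ← Finset.smul_sum, hK']
    simp only [smul_sub]
    abel
  · push_cast
    gcongr

/-- Matrix Chernoff bound (upper and lower tails, counting form) for a sampled decomposition of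
the identity. -/
theorem card_filter_sample_le {E : Type*} [Fintype E] [DecidableEq E] {K : Matrix V V ℝ}
    (hK : K.PosSemidef) {A : E → Matrix V V ℝ} {T : Finset E} (hA : ∀ e ∈ T, (A e).PosSemidef)
    (hsum : K + ∑ e ∈ T, A e = 1) {S : ℝ} (hS : 0 < S)
    (hAS : ∀ e ∈ T, ((S / 4) • 1 - A e).PosSemidef) {t c r : ℝ}
    (hr : Real.exp t - 1 - t * c ≤ r) {B : Finset (E → Fin 4)}
    (hB : ∀ σ ∈ B, ∃ h : (K + ∑ e ∈ T.filter (fun e => σ e = 0), (4 : ℝ) • A e).IsHermitian,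
      ∃ i, t * c ≤ t * h.eigenvalues i) :
    (B.card : ℝ) ≤ Fintype.card V * Real.exp (r / S) * 4 ^ Fintype.card E := by
  have hnn (σ : E → Fin 4) (_ : σ ∈ Finset.univ) : 0 ≤ (NormedSpace.exp
      ((t / S) • (K + ∑ e ∈ T.filter (fun e => σ e = 0), (4 : ℝ) • A e))).trace := by
    refine (IsHermitian.posSemidef_exp ?_).trace_nonneg
    refine IsHermitian.smul ?_ (.all _)
    refine (hK.add (posSemidef_sum _ fun e he => ?_)).1
    exact (hA e (Finset.mem_filter.1 he).1).smul (by norm_num)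
  have h1 : B.card * Real.exp (t * c / S) ≤ ∑ σ : E → Fin 4, (NormedSpace.exp
      ((t / S) • (K + ∑ e ∈ T.filter (fun e => σ e = 0), (4 : ℝ) • A e))).trace := by
    rw [← nsmul_eq_mul]
    refine (Finset.card_nsmul_le_sum B _ _ fun σ hσ => ?_).trans
      (Finset.sum_le_sum_of_subset_of_nonneg (Finset.subset_univ B) fun σ hσ _ => hnn σ hσ)
    obtain ⟨h, i, hi⟩ := hB σ hσ
    rw [h.trace_exp_smul]
    refine le_trans ?_ (Finset.single_le_sum (fun j _ => (Real.exp_pos _).le) (Finset.mem_univ i))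
    rw [Real.exp_le_exp, div_mul_eq_mul_div]
    gcongr
  have h2 := h1.trans (sum_trace_exp_sample_le hK hA hsum hS hAS t)
  rw [← le_div_iff₀ (Real.exp_pos _)] at h2
  refine h2.trans (le_of_eq_of_le (b := Fintype.card V * Real.exp ((Real.exp t - 1 - t * c) / S)
    * 4 ^ Fintype.card E) ?_ ?_)
  · rw [sub_div _ (t * c), Real.exp_sub]; ring
  · gcongr


theorem _root_.Real.sub_one_add_mul_log_one_add_le {x : ℝ} (hx0 : 0 ≤ x) (hx1 : x ≤ 1) :
    x - (1 + x) * Real.log (1 + x) ≤ -x ^ 2 / 3 := by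
  have h := Real.le_log_one_add_of_nonneg hx0
  have h1 : x + x ^ 2 / 3 ≤ (1 + x) * (2 * x / (x + 2)) := by
    rw [mul_div_assoc', le_div_iff₀ (by linarith)]
    nlinarith [mul_nonneg (sq_nonneg x) (sub_nonneg.2 hx1)]
  nlinarith [mul_le_mul_of_nonneg_left h (by linarith : 0 ≤ 1 + x)]

theorem _root_.Real.exp_neg_le_one_sub_add_sq {x : ℝ} (hx : 0 ≤ x) :
    Real.exp (-x) ≤ 1 - x + x ^ 2 / 2 := by
  have h := Real.quadratic_le_exp_of_nonneg hx
  rw [Real.exp_neg, inv_le_iff_one_le_mul₀ (Real.exp_pos x)]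
  nlinarith [mul_le_mul_of_nonneg_left h (by nlinarith [sq_nonneg (x - 1)] : 0 ≤ 1 - x + x ^ 2 / 2),
    pow_nonneg hx 4]

/-- Two-sided approximation of a positive definite matrix by sampling its summands. -/
theorem PosDef.card_sample_not_approx_le {E : Type*} [Fintype E] [DecidableEq E]
    {L K : Matrix V V ℝ} (hL : L.PosDef) (hK : K.PosSemidef) {M : E → Matrix V V ℝ} {T : Finset E}
    (hM : ∀ e ∈ T, (M e).PosSemidef) (hsum : K + ∑ e ∈ T, M e = L) {S ε : ℝ} (hS : 0 < S)
    (hε0 : 0 ≤ ε) (hε1 : ε ≤ 1) (hMS : ∀ e ∈ T, ((S / 4) • L - M e).PosSemidef)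
    {B : Finset (E → Fin 4)}
    (hB : ∀ σ ∈ B, ¬ ((K + ∑ e ∈ T.filter (fun e => σ e = 0), (4 : ℝ) • M e
        - (1 - ε) • L).PosSemidef ∧
      ((1 + ε) • L - (K + ∑ e ∈ T.filter (fun e => σ e = 0), (4 : ℝ) • M e)).PosSemidef)) :
    (B.card : ℝ) ≤
      2 * Fintype.card V * Real.exp (-ε ^ 2 / (3 * S)) * 4 ^ Fintype.card E := by
  classical
  obtain ⟨R, hR, hRL⟩ : ∃ R : Matrix V V ℝ, IsUnit R ∧ star R * L * R = 1 := by
    open scoped MatrixOrder in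
    obtain ⟨C, hC⟩ := CStarAlgebra.nonneg_iff_eq_star_mul_self.mp hL.posSemidef.nonneg
    have hCu : IsUnit C := by
      have := hL.isUnit
      rw [isUnit_iff_isUnit_det, hC, det_mul, IsUnit.mul_iff] at this
      exact (isUnit_iff_isUnit_det C).2 this.2
    lift C to (Matrix V V ℝ)ˣ using hCu
    refine ⟨(C⁻¹ : (Matrix V V ℝ)ˣ), Units.isUnit _, ?_⟩
    rw [hC, mul_assoc, mul_assoc, Units.mul_inv, mul_one, ← star_mul, Units.mul_inv, star_one]
  obtain ⟨f, hf⟩ : ∃ f : Matrix V V ℝ →ₗ[ℝ] Matrix V V ℝ, ∀ N, f N = star R * N * R :=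
    ⟨LinearMap.mulRight ℝ R ∘ₗ LinearMap.mulLeft ℝ (star R), fun _ => rfl⟩
  have hfp (N : Matrix V V ℝ) : (f N).PosSemidef ↔ N.PosSemidef := by
    rw [hf, hR.posSemidef_star_left_conjugate_iff]
  have hfL : f L = 1 := by rw [hf, hRL]
  let X (σ : E → Fin 4) : Matrix V V ℝ :=
    K + ∑ e ∈ T.filter (fun e => σ e = 0), (4 : ℝ) • M e
  have hX (σ : E → Fin 4) : f (X σ) = f K + ∑ e ∈ T.filter (fun e => σ e = 0), (4 : ℝ) • f (M e) := by
    simp [X, map_add, map_sum, map_smul]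
  have hXp (σ : E → Fin 4) : (f (X σ)).PosSemidef := by
    rw [hfp]
    exact hK.add (posSemidef_sum _ fun e he =>
      (hM e (Finset.mem_filter.1 he).1).smul (by norm_num))
  have hK' := (hfp K).2 hK
  have hM' : ∀ e ∈ T, (f (M e)).PosSemidef := fun e he => (hfp _).2 (hM e he)
  have hsum' : f K + ∑ e ∈ T, f (M e) = 1 := by rw [← map_sum, ← map_add, hsum, hfL]
  have hMS' : ∀ e ∈ T, ((S / 4) • 1 - f (M e)).PosSemidef := fun e he => by
    rw [← hfL, ← map_smul, ← map_sub, hfp]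
    exact hMS e he
  have hup := card_filter_sample_le (t := Real.log (1 + ε)) (c := 1 + ε) (r := -ε ^ 2 / 3)
    (B := B.filter fun σ => ¬ ((1 + ε) • L - X σ).PosSemidef) hK' hM' hsum' hS hMS'
    (by rw [Real.exp_log (by linarith)]; linarith [Real.sub_one_add_mul_log_one_add_le hε0 hε1])
    (fun σ hσ => by
      rw [← hX]
      refine ⟨(hXp σ).1, ?_⟩
      have h := (Finset.mem_filter.1 hσ).2
      rw [← hfp, map_sub, map_smul, hfL, (hXp σ).1.posSemidef_smul_one_sub_iff] at h
      push Not at h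
      obtain ⟨i, hi⟩ := h
      exact ⟨i, mul_le_mul_of_nonneg_left hi.le (Real.log_nonneg (by linarith))⟩)
  have hlow := card_filter_sample_le (t := -ε) (c := 1 - ε) (r := -ε ^ 2 / 3)
    (B := B.filter fun σ => ¬ (X σ - (1 - ε) • L).PosSemidef) hK' hM' hsum' hS hMS'
    (by nlinarith [Real.exp_neg_le_one_sub_add_sq hε0])
    (fun σ hσ => by
      rw [← hX]
      refine ⟨(hXp σ).1, ?_⟩
      have h := (Finset.mem_filter.1 hσ).2
      rw [← hfp, map_sub, map_smul, hfL, (hXp σ).1.posSemidef_sub_smul_one_iff] at h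
      push Not at h
      obtain ⟨i, hi⟩ := h
      exact ⟨i, mul_le_mul_of_nonpos_left hi.le (by linarith)⟩)
  have hcard : B.card ≤ (B.filter fun σ => ¬ ((1 + ε) • L - X σ).PosSemidef).card +
      (B.filter fun σ => ¬ (X σ - (1 - ε) • L).PosSemidef).card := by
    refine (Finset.card_le_card fun σ hσ => ?_).trans (Finset.card_union_le _ _)
    rw [Finset.mem_union, Finset.mem_filter, Finset.mem_filter]
    have := hB σ hσ
    tauto
  have hcard' : (B.card : ℝ) ≤ _ := Nat.cast_le.2 hcard
  rw [Nat.cast_add] at hcard'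
  rw [div_div] at hup hlow
  linarith

open Filter Topology in
theorem IsHermitian.eventually_not_posSemidef_add_smul_one {N : Matrix V V ℝ}
    (hN : N.IsHermitian) (hN' : ¬ N.PosSemidef) (c : ℝ) :
    ∀ᶠ δ : ℝ in 𝓝 0, ¬ (N + (c * δ) • 1).PosSemidef := by
  rw [posSemidef_iff_dotProduct_mulVec] at hN'
  push Not at hN'
  obtain ⟨x, hx⟩ := hN' hN
  have hcont : Continuous fun δ : ℝ => star x ⬝ᵥ N *ᵥ x + c * δ * (star x ⬝ᵥ x) := by fun_prop
  have hlt : star x ⬝ᵥ N *ᵥ x + c * 0 * (star x ⬝ᵥ x) < 0 := by simpa using hx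
  filter_upwards [(hcont.tendsto 0).eventually (gt_mem_nhds hlt)] with δ hδ hpos
  have := hpos.dotProduct_mulVec_nonneg x
  rw [add_mulVec, smul_mulVec, one_mulVec, dotProduct_add, dotProduct_smul, smul_eq_mul] at this
  exact absurd this (not_le.2 hδ)

end

end Matrix

/-- Correctness of one round of Light-SS: uniform sampling (with probability 1/4,
rescaling by 4) of the non-bundle edges yields a `(1±ε)`-spectral approximation of `L`
for all but a `2 n exp(-ε²/(3S))` fraction of the sample space. -/
theorem lightSS_sampling {V E : Type*} [Fintype V] [Fintype E] [DecidableEq E]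
    (n : ℕ) (hn : n = Fintype.card V) (hn1 : 1 ≤ n)
    (M : E → Matrix V V ℝ) (hM : ∀ e : E, (M e).PosSemidef)
    (L : Matrix V V ℝ) (hL : L = ∑ e, M e)
    (J : Finset E) (S ε : ℝ) (hS0 : 0 < S) (hS1 : S ≤ 1)
    (hε0 : 0 ≤ ε) (hε1 : ε ≤ 1)
    (hbundle : ∀ e ∉ J, ((S / 4) • L - M e).PosSemidef)
    (LH : (E → Fin 4) → Matrix V V ℝ)
    (hLH : ∀ σ : E → Fin 4, LH σ = (∑ e ∈ J, M e) +
      ∑ e ∈ Finset.univ.filter (fun e => e ∉ J ∧ σ e = 0), (4 : ℝ) • M e) :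
    (({σ : E → Fin 4 | ¬ ((LH σ - (1 - ε) • L).PosSemidef ∧
        ((1 + ε) • L - LH σ).PosSemidef)} : Set (E → Fin 4)).ncard : ℝ) ≤
      2 * n * Real.exp (-ε ^ 2 / (3 * S)) * 4 ^ (Fintype.card E) := by
  classical
  have hLp : L.PosSemidef := hL ▸ posSemidef_sum _ fun e _ => hM e
  have hJp : (∑ e ∈ J, M e).PosSemidef := posSemidef_sum _ fun e _ => hM e
  have hfilter (σ : E → Fin 4) : Finset.univ.filter (fun e => e ∉ J ∧ σ e = 0)
      = Jᶜ.filter (fun e => σ e = 0) := by ext e; simp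
  have hLHp (σ : E → Fin 4) : (LH σ).PosSemidef := by
    rw [hLH]
    exact hJp.add (posSemidef_sum _ fun e _ => (hM e).smul (by norm_num))
  have hlow (σ : E → Fin 4) : (LH σ - (1 - ε) • L).IsHermitian :=
    (hLHp σ).1.sub (hLp.smul (by linarith)).1
  have hup (σ : E → Fin 4) : ((1 + ε) • L - LH σ).IsHermitian :=
    (hLp.smul (by linarith)).1.sub (hLHp σ).1
  have hev : ∀ᶠ δ : ℝ in nhds 0, ∀ σ : E → Fin 4, ¬ ((LH σ - (1 - ε) • L).PosSemidef ∧
      ((1 + ε) • L - LH σ).PosSemidef) → ¬ ((LH σ - (1 - ε) • L + (ε * δ) • 1).PosSemidef ∧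
      ((1 + ε) • L - LH σ + (ε * δ) • 1).PosSemidef) := by
    refine Filter.eventually_all.2 fun σ => Filter.eventually_imp_distrib_left.2 fun h => ?_
    rcases not_and_or.1 h with h | h
    · filter_upwards [(hlow σ).eventually_not_posSemidef_add_smul_one h ε] with δ hδ hc
      exact hδ hc.1
    · filter_upwards [(hup σ).eventually_not_posSemidef_add_smul_one h ε] with δ hδ hc
      exact hδ hc.2
  obtain ⟨δ, hδ, hδ0⟩ := ((hev.filter_mono nhdsWithin_le_nhds).and
    (self_mem_nhdsWithin : Set.Ioi (0 : ℝ) ∈ nhdsWithin 0 (Set.Ioi 0))).exists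
  replace hδ0 : 0 < δ := hδ0
  rw [hn, Set.ncard_eq_toFinset_card']
  refine PosDef.card_sample_not_approx_le (L := L + δ • 1) (K := ∑ e ∈ J, M e + δ • 1) (M := M)
    (T := Jᶜ) (PosDef.posSemidef_add hLp (PosDef.one.smul hδ0)) (hJp.add (PosSemidef.one.smul hδ0.le)) (fun e _ => hM e) ?_
    hS0 hε0 hε1 (fun e he => ?_) (fun σ hσ => ?_)
  · rw [hL, ← Finset.sum_add_sum_compl J]; abel
  · have h : (S / 4) • (L + δ • 1) - M e = (S / 4) • L - M e + (S / 4 * δ) • 1 := by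
      rw [smul_add, smul_smul]; abel
    rw [h]
    exact (hbundle e (Finset.mem_compl.1 he)).add (PosSemidef.one.smul (by positivity))
  · have h := hδ σ (by simpa using hσ)
    have hX : ∑ e ∈ J, M e + δ • 1 + ∑ e ∈ Jᶜ.filter (fun e => σ e = 0), (4 : ℝ) • M e
        = LH σ + δ • 1 := by
      rw [hLH, hfilter]; abel
    rw [hX]
    convert h using 3 <;> module
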